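/- Let φ be as in the conserved-energy setting (solving the perturbation equation with φ_s vanishing at the endpoints of I = (0, θR), θ ∈ (0, π)), and suppose φ(·,0) = φ₀ is not constant. Then ‖φ_ss(t)‖ ≥ (1 − θ²/π²)^{1/2} ‖φ₀_ss‖ for all t > 0; in particular ‖φ_ss(t)‖ never vanishes. -/

import Mathlib

open MeasureTheory RealInnerProductSpace

noncomputable section

abbrev E3 := EuclideanSpace ℝ (Fin 3)

/-- Cross product on `ℝ³`. -/
def cross (u v : E3) : E3 :=
  (WithLp.equiv 2 (Fin 3 → ℝ)).symm
    ![u 1 * v 2 - u 2 * v 1, u 2 * v 0 - u 0 * v 2, u 0 * v 1 - u 1 * v 0]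

/-- Partial derivative in the first (space) variable. -/
def pd1 (f : ℝ → ℝ → E3) (s t : ℝ) : E3 := deriv (fun s' => f s' t) s

/-- Partial derivative in the second (time) variable. -/
def pd2 (f : ℝ → ℝ → E3) (s t : ℝ) : E3 := deriv (fun t' => f s t') t

/-- The arc-shaped filament. -/
def xR (R : ℝ) (s t : ℝ) : E3 :=
  (WithLp.equiv 2 (Fin 3 → ℝ)).symm ![R * Real.cos (s / R), R * Real.sin (s / R), t / R]

/-! ### Smoothness and symmetry of partial derivatives -/

section PartialDerivatives

variable {f : ℝ → ℝ → E3}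

lemma hasDerivAt_fst_of_contDiff (hf : ContDiff ℝ (⊤ : ℕ∞) (fun p : ℝ × ℝ => f p.1 p.2))
    (s t : ℝ) :
    HasDerivAt (fun s' => f s' t) (fderiv ℝ (fun p : ℝ × ℝ => f p.1 p.2) (s, t) (1, 0)) s := by
  have h := (hf.differentiable (by simp) (s, t)).hasFDerivAt
  exact h.comp_hasDerivAt s ((hasDerivAt_id s).prodMk (hasDerivAt_const s t))

lemma hasDerivAt_snd_of_contDiff (hf : ContDiff ℝ (⊤ : ℕ∞) (fun p : ℝ × ℝ => f p.1 p.2))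
    (s t : ℝ) :
    HasDerivAt (fun t' => f s t') (fderiv ℝ (fun p : ℝ × ℝ => f p.1 p.2) (s, t) (0, 1)) t := by
  have h := (hf.differentiable (by simp) (s, t)).hasFDerivAt
  exact h.comp_hasDerivAt t ((hasDerivAt_const t s).prodMk (hasDerivAt_id t))

lemma pd1_eq_fderiv (hf : ContDiff ℝ (⊤ : ℕ∞) (fun p : ℝ × ℝ => f p.1 p.2)) (s t : ℝ) :
    pd1 f s t = fderiv ℝ (fun p : ℝ × ℝ => f p.1 p.2) (s, t) (1, 0) :=
  (hasDerivAt_fst_of_contDiff hf s t).deriv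

lemma pd2_eq_fderiv (hf : ContDiff ℝ (⊤ : ℕ∞) (fun p : ℝ × ℝ => f p.1 p.2)) (s t : ℝ) :
    pd2 f s t = fderiv ℝ (fun p : ℝ × ℝ => f p.1 p.2) (s, t) (0, 1) :=
  (hasDerivAt_snd_of_contDiff hf s t).deriv

lemma hasDerivAt_pd1 (hf : ContDiff ℝ (⊤ : ℕ∞) (fun p : ℝ × ℝ => f p.1 p.2)) (s t : ℝ) :
    HasDerivAt (fun s' => f s' t) (pd1 f s t) s :=
  (hasDerivAt_fst_of_contDiff hf s t).differentiableAt.hasDerivAt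

lemma hasDerivAt_pd2 (hf : ContDiff ℝ (⊤ : ℕ∞) (fun p : ℝ × ℝ => f p.1 p.2)) (s t : ℝ) :
    HasDerivAt (fun t' => f s t') (pd2 f s t) t :=
  (hasDerivAt_snd_of_contDiff hf s t).differentiableAt.hasDerivAt

lemma contDiff_pd1 (hf : ContDiff ℝ (⊤ : ℕ∞) (fun p : ℝ × ℝ => f p.1 p.2)) :
    ContDiff ℝ (⊤ : ℕ∞) (fun p : ℝ × ℝ => pd1 f p.1 p.2) := by
  simp_rw [pd1_eq_fderiv hf]
  exact (hf.fderiv_right (by simp)).clm_apply contDiff_const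

lemma contDiff_pd2 (hf : ContDiff ℝ (⊤ : ℕ∞) (fun p : ℝ × ℝ => f p.1 p.2)) :
    ContDiff ℝ (⊤ : ℕ∞) (fun p : ℝ × ℝ => pd2 f p.1 p.2) := by
  simp_rw [pd2_eq_fderiv hf]
  exact (hf.fderiv_right (by simp)).clm_apply contDiff_const

lemma pd2_pd1_comm (hf : ContDiff ℝ (⊤ : ℕ∞) (fun p : ℝ × ℝ => f p.1 p.2)) (s t : ℝ) :
    pd2 (pd1 f) s t = pd1 (pd2 f) s t := by
  have hd : DifferentiableAt ℝ (fderiv ℝ (fun p : ℝ × ℝ => f p.1 p.2)) (s, t) :=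
    (hf.fderiv_right (m := 1) (WithTop.coe_le_coe.2 le_top)).differentiable one_ne_zero _
  have hsymm := (hf.contDiffAt (x := (s, t))).isSymmSndFDerivAt
    (by rw [minSmoothness_of_isRCLikeNormedField]; exact WithTop.coe_le_coe.2 le_top)
  rw [pd2_eq_fderiv (contDiff_pd1 hf), pd1_eq_fderiv (contDiff_pd2 hf)]
  simp_rw [pd1_eq_fderiv hf, pd2_eq_fderiv hf]
  rw [fderiv_clm_apply hd (differentiableAt_const _), fderiv_clm_apply hd (differentiableAt_const _)]
  simpa using hsymm (0, 1) (1, 0)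

end PartialDerivatives

/-! ### Calculus in `ℝ³` -/

lemma hasDerivAt_vec3 {a b c : ℝ → ℝ} {a' b' c' x : ℝ} (ha : HasDerivAt a a' x)
    (hb : HasDerivAt b b' x) (hc : HasDerivAt c c' x) :
    HasDerivAt (fun y => ((WithLp.equiv 2 (Fin 3 → ℝ)).symm ![a y, b y, c y] : E3))
      ((WithLp.equiv 2 (Fin 3 → ℝ)).symm ![a', b', c']) x := by
  refine (EuclideanSpace.equiv (Fin 3) ℝ).symm.hasFDerivAt.comp_hasDerivAt x (hasDerivAt_pi.2 ?_)
  intro i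
  fin_cases i
  exacts [ha, hb, hc]

lemma HasDerivAt.apply_E3 {f : ℝ → E3} {f' : E3} {x : ℝ} (h : HasDerivAt f f' x) (i : Fin 3) :
    HasDerivAt (fun y => f y i) (f' i) x :=
  (EuclideanSpace.proj (𝕜 := ℝ) i).hasFDerivAt.comp_hasDerivAt x h

lemma HasDerivAt.cross {f g : ℝ → E3} {f' g' : E3} {x : ℝ} (hf : HasDerivAt f f' x)
    (hg : HasDerivAt g g' x) :
    HasDerivAt (fun y => cross (f y) (g y)) (cross f' (g x) + cross (f x) g') x := by
  have hF := hf.apply_E3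
  have hG := hg.apply_E3
  refine (hasDerivAt_vec3 (((hF 1).mul (hG 2)).sub ((hF 2).mul (hG 1)))
    (((hF 2).mul (hG 0)).sub ((hF 0).mul (hG 2)))
    (((hF 0).mul (hG 1)).sub ((hF 1).mul (hG 0)))).congr_deriv ?_
  ext i
  fin_cases i <;> simp [_root_.cross] <;> ring

/-- The cancellation behind the conservation of energy: the equation for `v = φ_s` is
`v_t = (v + x_s) × (v_ss + R⁻² v)`. -/
lemma inner_cross_cancel (v w z T N : E3) (c : ℝ) :
    ⟪cross w w + cross v z + (cross N w + cross T z) + (cross w N + cross v (-c • T)),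
      z + c • v⟫ = 0 := by
  simp [cross, PiLp.inner_apply, Fin.sum_univ_three]
  ring

/-! ### The arc-shaped filament -/

section Arc

variable {R : ℝ}

lemma hasDerivAt_xR (hR : R ≠ 0) (s t : ℝ) :
    HasDerivAt (fun s' => xR R s' t)
      ((WithLp.equiv 2 (Fin 3 → ℝ)).symm ![-Real.sin (s / R), Real.cos (s / R), 0]) s := by
  have hd : HasDerivAt (fun y : ℝ => y / R) (1 / R) s := (hasDerivAt_id s).div_const R
  refine (hasDerivAt_vec3 (hd.cos.const_mul R) (hd.sin.const_mul R)
    (hasDerivAt_const s (t / R))).congr_deriv ?_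
  ext i
  fin_cases i <;> simp <;> field_simp

lemma pd1_xR (hR : R ≠ 0) (s t : ℝ) :
    pd1 (xR R) s t =
      (WithLp.equiv 2 (Fin 3 → ℝ)).symm ![-Real.sin (s / R), Real.cos (s / R), 0] :=
  (hasDerivAt_xR hR s t).deriv

lemma hasDerivAt_pd1_xR (hR : R ≠ 0) (s t : ℝ) :
    HasDerivAt (fun s' => pd1 (xR R) s' t)
      ((WithLp.equiv 2 (Fin 3 → ℝ)).symm
        ![-(1 / R) * Real.cos (s / R), -(1 / R) * Real.sin (s / R), 0]) s := by
  have hd : HasDerivAt (fun y : ℝ => y / R) (1 / R) s := (hasDerivAt_id s).div_const R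
  simp_rw [pd1_xR hR]
  refine (hasDerivAt_vec3 hd.sin.neg hd.cos (hasDerivAt_const s 0)).congr_deriv ?_
  ext i
  fin_cases i <;> simp <;> field_simp

lemma pd1_pd1_xR (hR : R ≠ 0) (s t : ℝ) :
    pd1 (pd1 (xR R)) s t = (WithLp.equiv 2 (Fin 3 → ℝ)).symm
        ![-(1 / R) * Real.cos (s / R), -(1 / R) * Real.sin (s / R), 0] :=
  (hasDerivAt_pd1_xR hR s t).deriv

lemma hasDerivAt_pd1_pd1_xR (hR : R ≠ 0) (s t : ℝ) :
    HasDerivAt (fun s' => pd1 (pd1 (xR R)) s' t) (-(1 / R ^ 2) • pd1 (xR R) s t) s := by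
  have hd : HasDerivAt (fun y : ℝ => y / R) (1 / R) s := (hasDerivAt_id s).div_const R
  simp_rw [pd1_pd1_xR hR, pd1_xR hR]
  refine (hasDerivAt_vec3 (hd.cos.const_mul (-(1 / R)))
    (hd.sin.const_mul (-(1 / R))) (hasDerivAt_const s 0)).congr_deriv ?_
  ext i
  fin_cases i <;> simp <;> field_simp

end Arc

/-! ### The sharp Poincaré inequality -/

lemma poincare_of_mul_lt_pi {L k : ℝ} (hL : 0 < L) (hk : 0 < k) (hkL : k * L < Real.pi)
    {f f' : ℝ → E3} (hf : ∀ s, HasDerivAt f (f' s) s) (hf' : Continuous f')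
    (h0 : f 0 = 0) (h1 : f L = 0) :
    k ^ 2 * ∫ s in (0 : ℝ)..L, ‖f s‖ ^ 2 ≤ ∫ s in (0 : ℝ)..L, ‖f' s‖ ^ 2 := by
  have hfc : Continuous f := continuous_iff_continuousAt.2 fun s => (hf s).continuousAt
  set T : ℝ → ℝ := fun s => Real.tan (k * (s - L / 2)) with hT
  have hcos : ∀ s ∈ Set.uIcc 0 L, 0 < Real.cos (k * (s - L / 2)) := by
    intro s hs
    rw [Set.uIcc_of_le hL.le] at hs
    apply Real.cos_pos_of_mem_Ioo
    constructor <;> nlinarith [hs.1, hs.2]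
  have hTd : ∀ s ∈ Set.uIcc 0 L, HasDerivAt T (k * (1 + T s ^ 2)) s := by
    intro s hs
    have h := (Real.hasDerivAt_tan (hcos s hs).ne').comp s
      (((hasDerivAt_id s).sub_const (L / 2)).const_mul k)
    refine h.congr_deriv ?_
    rw [one_div, ← Real.inv_one_add_tan_sq (hcos s hs).ne', inv_inv]
    ring
  have hTc : ContinuousOn T (Set.uIcc 0 L) := fun s hs => (hTd s hs).continuousAt.continuousWithinAt
  have hder : ∀ s ∈ Set.uIcc 0 L, HasDerivAt (fun s => k * T s * ‖f s‖ ^ 2)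
      (k * (k * (1 + T s ^ 2)) * ‖f s‖ ^ 2 + k * T s * (2 * ⟪f s, f' s⟫)) s := fun s hs =>
    ((hTd s hs).const_mul k).mul (hf s).norm_sq
  have hcont : ContinuousOn (fun s => k * (k * (1 + T s ^ 2)) * ‖f s‖ ^ 2
      + k * T s * (2 * ⟪f s, f' s⟫)) (Set.uIcc 0 L) := by
    have h1 := hfc.continuousOn (s := Set.uIcc 0 L)
    have h2 := hf'.continuousOn (s := Set.uIcc 0 L)
    fun_prop
  have hint := intervalIntegral.integral_eq_sub_of_hasDerivAt hder hcont.intervalIntegrable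
  rw [h0, h1] at hint
  have i1 : IntervalIntegrable (fun s => ‖f' s‖ ^ 2) volume 0 L :=
    (by fun_prop : Continuous fun s => ‖f' s‖ ^ 2).intervalIntegrable _ _
  have i2 : IntervalIntegrable (fun s => k ^ 2 * ‖f s‖ ^ 2) volume 0 L :=
    (by fun_prop : Continuous fun s => k ^ 2 * ‖f s‖ ^ 2).intervalIntegrable _ _
  have hnonneg : 0 ≤ ∫ s in (0 : ℝ)..L, (‖f' s‖ ^ 2 - k ^ 2 * ‖f s‖ ^ 2
      + (k * (k * (1 + T s ^ 2)) * ‖f s‖ ^ 2 + k * T s * (2 * ⟪f s, f' s⟫))) := by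
    refine intervalIntegral.integral_nonneg hL.le fun s _ => ?_
    have h := sq_nonneg ‖f' s + (k * T s) • f s‖
    rw [norm_add_sq_real, norm_smul, mul_pow, Real.norm_eq_abs, sq_abs, inner_smul_right,
      real_inner_comm] at h
    linarith
  rw [intervalIntegral.integral_add (i1.sub i2) hcont.intervalIntegrable,
    intervalIntegral.integral_sub i1 i2, hint, intervalIntegral.integral_const_mul] at hnonneg
  simp at hnonneg
  linarith

/-- The sharp Poincaré inequality on `[0, L]` for functions vanishing at the endpoints. -/
lemma poincare {L : ℝ} (hL : 0 < L) {f f' : ℝ → E3} (hf : ∀ s, HasDerivAt f (f' s) s)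
    (hf' : Continuous f') (h0 : f 0 = 0) (h1 : f L = 0) :
    (Real.pi / L) ^ 2 * ∫ s in (0 : ℝ)..L, ‖f s‖ ^ 2 ≤ ∫ s in (0 : ℝ)..L, ‖f' s‖ ^ 2 := by
  have hpos : 0 < Real.pi / L := by positivity
  have hlim : Filter.Tendsto (fun k : ℝ => k ^ 2 * ∫ s in (0 : ℝ)..L, ‖f s‖ ^ 2)
      (nhdsWithin (Real.pi / L) (Set.Iio (Real.pi / L)))
      (nhds ((Real.pi / L) ^ 2 * ∫ s in (0 : ℝ)..L, ‖f s‖ ^ 2)) :=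
    ((continuous_id.pow 2).mul continuous_const).continuousAt.tendsto.mono_left nhdsWithin_le_nhds
  refine le_of_tendsto hlim ?_
  filter_upwards [Ioo_mem_nhdsLT hpos] with k hk
  exact poincare_of_mul_lt_pi hL hk.1 ((lt_div_iff₀ hL).1 hk.2) hf hf' h0 h1

/-! ### Conservation of the energy -/

lemma hasDerivAt_intervalIntegral_of_continuous {F G : ℝ → ℝ → ℝ} {a b : ℝ}
    (hF : Continuous fun p : ℝ × ℝ => F p.1 p.2) (hG : Continuous fun p : ℝ × ℝ => G p.1 p.2)
    (h : ∀ s t, HasDerivAt (fun t' => F s t') (G s t) t) (t : ℝ) :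
    HasDerivAt (fun t' => ∫ s in a..b, F s t') (∫ s in a..b, G s t) t := by
  obtain ⟨C, hC⟩ := ((isCompact_uIcc (a := a) (b := b)).prod
    (isCompact_Icc (a := t - 1) (b := t + 1))).exists_bound_of_continuousOn hG.continuousOn
  have hFt : ∀ t', Continuous fun s => F s t' := fun t' =>
    hF.comp (f := fun s : ℝ => (s, t')) (by fun_prop)
  have hGt : Continuous fun s => G s t := hG.comp (f := fun s : ℝ => (s, t)) (by fun_prop)
  refine (intervalIntegral.hasDerivAt_integral_of_dominated_loc_of_deriv_le
    (F := fun t' s => F s t') (F' := fun t' s => G s t') (bound := fun _ => C)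
    (Icc_mem_nhds (sub_one_lt t) (lt_add_one t))
    (Filter.Eventually.of_forall fun t' => (hFt t').aestronglyMeasurable)
    ((hFt t).intervalIntegrable _ _) hGt.aestronglyMeasurable
    (Filter.Eventually.of_forall fun s hs t' ht' => ?_) intervalIntegrable_const
    (Filter.Eventually.of_forall fun s _ t' _ => h s t')).2
  exact hC (s, t') ⟨Set.uIoc_subset_uIcc hs, ht'⟩

/-- The energy of a field `v` on `[0, L]`, with `v` playing the role of `φ_s`. -/
def energy (R L : ℝ) (v : ℝ → ℝ → E3) (t : ℝ) : ℝ :=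
  ∫ s in (0 : ℝ)..L, (‖pd1 v s t‖ ^ 2 - 1 / R ^ 2 * ‖v s t‖ ^ 2)

section Energy

variable {R L : ℝ} {v : ℝ → ℝ → E3}

lemma hasDerivAt_energy (hv : ContDiff ℝ (⊤ : ℕ∞) (fun p : ℝ × ℝ => v p.1 p.2)) (t : ℝ) :
    HasDerivAt (energy R L v) (∫ s in (0 : ℝ)..L,
      (2 * ⟪pd1 v s t, pd1 (pd2 v) s t⟫ - 1 / R ^ 2 * (2 * ⟪v s t, pd2 v s t⟫))) t := by
  have c0 := hv.continuous
  have c1 := (contDiff_pd1 hv).continuous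
  have c2 := (contDiff_pd2 hv).continuous
  have c12 := (contDiff_pd1 (contDiff_pd2 hv)).continuous
  refine hasDerivAt_intervalIntegral_of_continuous
    (F := fun s t => ‖pd1 v s t‖ ^ 2 - 1 / R ^ 2 * ‖v s t‖ ^ 2)
    (G := fun s t => 2 * ⟪pd1 v s t, pd1 (pd2 v) s t⟫ - 1 / R ^ 2 * (2 * ⟪v s t, pd2 v s t⟫))
    (by fun_prop) (by fun_prop) (fun s t => ?_) t
  have h1 := hasDerivAt_pd2 (contDiff_pd1 hv) s t
  rw [pd2_pd1_comm hv] at h1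
  exact h1.norm_sq.sub ((hasDerivAt_pd2 hv s t).norm_sq.const_mul _)

/-- The energy is stationary when `v_t` vanishes at the endpoints and is orthogonal to
`v_ss + R⁻² v` inside the interval. -/
lemma hasDerivAt_energy_zero (hL : 0 < L)
    (hv : ContDiff ℝ (⊤ : ℕ∞) (fun p : ℝ × ℝ => v p.1 p.2)) {t : ℝ}
    (h0 : pd2 v 0 t = 0) (h1 : pd2 v L t = 0)
    (horth : ∀ s ∈ Set.Ioo 0 L,
      ⟪pd2 v s t, pd1 (pd1 v) s t + (1 / R ^ 2) • v s t⟫ = 0) :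
    HasDerivAt (energy R L v) 0 t := by
  have hpair (s : ℝ) : HasDerivAt (fun s' => 2 * ⟪pd1 v s' t, pd2 v s' t⟫)
      (2 * (⟪pd1 v s t, pd1 (pd2 v) s t⟫ + ⟪pd1 (pd1 v) s t, pd2 v s t⟫)) s :=
    ((hasDerivAt_pd1 (contDiff_pd1 hv) s t).inner ℝ
      (hasDerivAt_pd1 (contDiff_pd2 hv) s t)).const_mul 2
  have slice {f : ℝ → ℝ → E3} (hf : ContDiff ℝ (⊤ : ℕ∞) (fun p : ℝ × ℝ => f p.1 p.2)) :
      Continuous fun s => f s t := hf.continuous.comp (f := fun s : ℝ => (s, t)) (by fun_prop)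
  have c1 := slice (contDiff_pd1 hv)
  have c2 := slice (contDiff_pd2 hv)
  have c11 := slice (contDiff_pd1 (contDiff_pd1 hv))
  have c12 := slice (contDiff_pd1 (contDiff_pd2 hv))
  have hint := intervalIntegral.integral_eq_sub_of_hasDerivAt (a := 0) (b := L)
    (fun s _ => hpair s) ((by fun_prop : Continuous _).intervalIntegrable _ _)
  rw [h0, h1, inner_zero_right, inner_zero_right, sub_self] at hint
  refine (hasDerivAt_energy (R := R) (L := L) hv t).congr_deriv (Eq.trans ?_ hint)
  rw [intervalIntegral.integral_of_le hL.le, intervalIntegral.integral_of_le hL.le,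
    integral_Ioc_eq_integral_Ioo, integral_Ioc_eq_integral_Ioo]
  refine setIntegral_congr_fun measurableSet_Ioo fun s hs => ?_
  have h := horth s hs
  rw [inner_add_right, inner_smul_right, real_inner_comm, real_inner_comm (v s t)] at h
  linear_combination (-2) * h

lemma energy_eq (hv : ContDiff ℝ (⊤ : ℕ∞) (fun p : ℝ × ℝ => v p.1 p.2)) (t : ℝ) :
    energy R L v t = (∫ s in (0 : ℝ)..L, ‖pd1 v s t‖ ^ 2)
      - 1 / R ^ 2 * ∫ s in (0 : ℝ)..L, ‖v s t‖ ^ 2 := by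
  have c0 : Continuous fun s => v s t :=
    hv.continuous.comp (f := fun s : ℝ => (s, t)) (by fun_prop)
  have c1 : Continuous fun s => pd1 v s t :=
    (contDiff_pd1 hv).continuous.comp (f := fun s : ℝ => (s, t)) (by fun_prop)
  rw [energy, intervalIntegral.integral_sub
    ((by fun_prop : Continuous _).intervalIntegrable _ _)
    ((by fun_prop : Continuous _).intervalIntegrable _ _), intervalIntegral.integral_const_mul]

end Energy

/-- The equation obtained by differentiating the perturbation equation in space, tested against
`φ_sss + R⁻² φ_s`. -/
lemma inner_pd2_pd1_eq_zero {R L : ℝ} (hR : R ≠ 0) {φ : ℝ → ℝ → E3}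
    (hsmooth : ContDiff ℝ (⊤ : ℕ∞) (fun p : ℝ × ℝ => φ p.1 p.2)) {t : ℝ}
    (heq : ∀ s ∈ Set.Ioo 0 L, pd2 φ s t = cross (pd1 φ s t) (pd1 (pd1 φ) s t)
        + cross (pd1 (xR R) s t) (pd1 (pd1 φ) s t)
        + cross (pd1 φ s t) (pd1 (pd1 (xR R)) s t)) {s : ℝ} (hs : s ∈ Set.Ioo 0 L) :
    ⟪pd2 (pd1 φ) s t, pd1 (pd1 (pd1 φ)) s t + (1 / R ^ 2) • pd1 φ s t⟫ = 0 := by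
  have hv := contDiff_pd1 hsmooth
  have d1 := hasDerivAt_pd1 hv s t
  have d2 := hasDerivAt_pd1 (contDiff_pd1 hv) s t
  have dT := (hasDerivAt_pd1_xR hR s t).differentiableAt.hasDerivAt
  have dN := hasDerivAt_pd1_pd1_xR hR s t
  have hrhs := ((d1.cross d2).add (dT.cross d2)).add (d1.cross dN)
  have hlhs := hrhs.congr_of_eventuallyEq (f₁ := fun s' => pd2 φ s' t)
    (Filter.eventuallyEq_of_mem (Ioo_mem_nhds hs.1 hs.2) heq)
  rw [pd2_pd1_comm hsmooth, pd1, hlhs.deriv]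
  exact inner_cross_cancel _ _ _ _ _ _

/-- lower bound for `‖φ_ss(t)‖` when the initial perturbation is not constant. -/
theorem curvature_perturbation_lower_bound (R θ : ℝ) (hR : 0 < R) (hθ : θ ∈ Set.Ioo 0 Real.pi)
    (φ : ℝ → ℝ → E3)
    (hsmooth : ContDiff ℝ (⊤ : ℕ∞) (fun p : ℝ × ℝ => φ p.1 p.2))
    (heq : ∀ s ∈ Set.Ioo (0:ℝ) (θ * R), ∀ t : ℝ, 0 < t →
      pd2 φ s t = cross (pd1 φ s t) (pd1 (pd1 φ) s t)
        + cross (pd1 (xR R) s t) (pd1 (pd1 φ) s t)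
        + cross (pd1 φ s t) (pd1 (pd1 (xR R)) s t))
    (hbc : ∀ t : ℝ, 0 ≤ t → pd1 φ 0 t = 0 ∧ pd1 φ (θ * R) t = 0)
    (hnc : ¬ ∃ c : E3, ∀ s ∈ Set.Icc (0:ℝ) (θ * R), φ s 0 = c) :
    ∀ t : ℝ, 0 < t →
      Real.sqrt (∫ s in (0:ℝ)..(θ * R), ‖pd1 (pd1 φ) s t‖ ^ 2)
        ≥ Real.sqrt (1 - θ ^ 2 / Real.pi ^ 2)
            * Real.sqrt (∫ s in (0:ℝ)..(θ * R), ‖pd1 (pd1 φ) s 0‖ ^ 2) := by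
  intro t ht
  have hL : 0 < θ * R := mul_pos hθ.1 hR
  have hv := contDiff_pd1 hsmooth
  have hder : ∀ τ, 0 < τ → HasDerivAt (energy R (θ * R) (pd1 φ)) 0 τ := by
    intro τ hτ
    have hzero (a : ℝ) (ha : ∀ t, 0 ≤ t → pd1 φ a t = 0) : pd2 (pd1 φ) a τ = 0 := by
      refine ((hasDerivAt_const τ (0 : E3)).congr_of_eventuallyEq ?_).deriv
      filter_upwards [Ioi_mem_nhds hτ] with τ' hτ'
      exact ha τ' (le_of_lt hτ')
    exact hasDerivAt_energy_zero hL hv (hzero 0 fun t ht => (hbc t ht).1)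
      (hzero (θ * R) fun t ht => (hbc t ht).2)
      fun s hs => inner_pd2_pd1_eq_zero hR.ne' hsmooth (fun s hs => heq s hs τ hτ) hs
  have hE : energy R (θ * R) (pd1 φ) t = energy R (θ * R) (pd1 φ) 0 := by
    obtain ⟨c, -, hc⟩ := exists_hasDerivAt_eq_slope (energy R (θ * R) (pd1 φ)) (fun _ => 0) ht
      (fun τ _ => (hasDerivAt_energy hv τ).continuousAt.continuousWithinAt)
      (fun τ hτ => hder τ hτ.1)
    rw [eq_div_iff (by linarith)] at hc
    linarith
  rw [energy_eq hv, energy_eq hv] at hE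
  have hP := poincare hL (fun s => hasDerivAt_pd1 hv s 0)
    ((contDiff_pd1 hv).continuous.comp (f := fun s : ℝ => (s, (0 : ℝ))) (by fun_prop))
    (hbc 0 le_rfl).1 (hbc 0 le_rfl).2
  have hnonneg : 0 ≤ ∫ s in (0 : ℝ)..(θ * R), ‖pd1 φ s t‖ ^ 2 :=
    intervalIntegral.integral_nonneg hL.le fun s _ => sq_nonneg _
  have hθ0 := hθ.1
  have hratio : θ ^ 2 / Real.pi ^ 2 ≤ 1 := by
    rw [div_le_one (by positivity)]
    exact pow_le_pow_left₀ hθ0.le hθ.2.le 2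
  have hP' := mul_le_mul_of_nonneg_left hP (by positivity : 0 ≤ θ ^ 2 / Real.pi ^ 2)
  have hcoef : θ ^ 2 / Real.pi ^ 2 * (Real.pi / (θ * R)) ^ 2 = 1 / R ^ 2 := by
    have := Real.pi_ne_zero
    field_simp
  rw [← mul_assoc, hcoef] at hP'
  rw [ge_iff_le, ← Real.sqrt_mul (by linarith)]
  apply Real.sqrt_le_sqrt
  have := mul_nonneg (by positivity : 0 ≤ 1 / R ^ 2) hnonneg
  linarith
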